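/- arXiv:0908.3159 — 2 statements merged into one kernel-verified Lean document; each statement's English description precedes it below -/
import Mathlib

section
/- For all p ≥ 3 and q ≥ 2, the surface Σ_{p,2q} can be realized as a polyhedral surface embedded in R^5, i.e. there is an embedding of Σ_{p,2q} into R^5 in which every 2-face is realized as a planar convex p-gon. -/
open Set

noncomputable section

def setDim {V : Type*} [AddCommGroup V] [Module ℝ V] (s : Set V) : ℕ :=
  Module.finrank ℝ (affineSpan ℝ s).direction

/-- Encoding vectors of the vertices of `Σ_{p,2q}`. -/
def IsVertVec (p q : ℕ) (H : ZMod p → Set (ZMod q)) : Prop :=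
  ∃ k : ZMod p, H k = Set.univ ∧ H (k + 1) = Set.univ ∧
    ∀ i, i ≠ k → i ≠ k + 1 → ∃ j : ZMod q, H i = {j}ᶜ

/-- The vertices of the `p`-gon face of `Σ_{p,2q}` encoded by `(j̄_0, …, j̄_{p-1})`. -/
def pgonVerts (p q : ℕ) (jv : ZMod p → ZMod q) : Set (ZMod p → Set (ZMod q)) :=
  {V | IsVertVec p q V ∧ ∀ i, ({jv i}ᶜ : Set (ZMod q)) ⊆ V i}

/-- Finitely many subspaces of dimension at most `n` admit a common linear map to `ℝⁿ` that is
injective on each of them. -/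
theorem exists_linearMap_disjoint_ker {ι : Type*} [Finite ι] (n d : ℕ) :
    ∀ {V : Type} [AddCommGroup V] [Module ℝ V] [FiniteDimensional ℝ V],
      Module.finrank ℝ V = d → ∀ W : ι → Submodule ℝ V, (∀ i, Module.finrank ℝ (W i) ≤ n) →
      ∃ f : V →ₗ[ℝ] (Fin n → ℝ), ∀ i, ∀ x ∈ W i, f x = 0 → x = 0 := by
  induction d with
  | zero =>
    intro V _ _ _ hd W _
    have := Module.finrank_zero_iff.mp hd
    exact ⟨0, fun i x _ _ => Subsingleton.elim _ _⟩
  | succ d ih =>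
    intro V _ _ _ hd W hW
    by_cases hdn : d + 1 ≤ n
    · obtain ⟨f, hf⟩ := (finrank_le_iff_exists_linearMap (R := ℝ) (M := V)
        (M' := Fin n → ℝ)).mp (by simpa [hd] using hdn)
      exact ⟨f, fun i x _ hx => hf (by simpa using hx)⟩
    · obtain ⟨v, hv⟩ : ∃ v, ∀ i, v ∉ W i := by
        by_contra! h
        have hU : (⋃ i, (W i : Set V)) = Set.univ := by
          ext x
          simpa using h x
        obtain ⟨i, hi⟩ := Subspace.exists_eq_top_of_iUnion_eq_univ hU
        have := hW i
        rw [hi, finrank_top, hd] at this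
        omega
      by_cases hι : IsEmpty ι
      · exact ⟨0, fun i => (hι.false i).elim⟩
      have hv0 : v ≠ 0 := by
        rintro rfl
        obtain ⟨i⟩ := not_isEmpty_iff.mp hι
        exact hv i (W i).zero_mem
      have hq : Module.finrank ℝ (V ⧸ Submodule.span ℝ {v}) = d := by
        have h1 := Submodule.finrank_quotient_add_finrank (Submodule.span ℝ {v})
        rw [finrank_span_singleton hv0, hd] at h1
        omega
      obtain ⟨f, hf⟩ := ih hq (fun i => (W i).map (Submodule.span ℝ {v}).mkQ)
        (fun i => (Submodule.finrank_map_le _ _).trans (hW i))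
      refine ⟨f ∘ₗ (Submodule.span ℝ {v}).mkQ, fun i x hx h0 => ?_⟩
      have h1 := hf i _ (Submodule.mem_map_of_mem hx) h0
      rw [Submodule.mkQ_apply, Submodule.Quotient.mk_eq_zero, Submodule.mem_span_singleton] at h1
      obtain ⟨a, rfl⟩ := h1
      by_cases ha : a = 0
      · simp [ha]
      · exact absurd (((W i).smul_mem_iff ha).mp hx) (hv i)

/-- The `k`-th vertex of the `p`-gon inscribed in the parabola. -/
def parabolaPt (p : ℕ) (k : ZMod p) : ℝ × ℝ := ((k.val : ℝ), (k.val : ℝ) ^ 2)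

/-- Linear part of the affine function supporting the `i`-th edge of the parabola `p`-gon. -/
def edgeLin (p : ℕ) (i : ZMod p) : ℝ × ℝ →ₗ[ℝ] ℝ :=
  if i = 0 then ((p : ℝ) - 1) • LinearMap.fst ℝ ℝ ℝ - LinearMap.snd ℝ ℝ ℝ
  else LinearMap.snd ℝ ℝ ℝ - (2 * (i.val : ℝ) - 1) • LinearMap.fst ℝ ℝ ℝ

/-- Constant term of the affine function supporting the `i`-th edge of the parabola `p`-gon. -/
def edgeConst (p : ℕ) (i : ZMod p) : ℝ :=
  if i = 0 then 0 else (i.val : ℝ) * ((i.val : ℝ) - 1)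

/-- The affine function that vanishes on the edge joining the vertices `i - 1` and `i` of the
parabola `p`-gon. -/
def edgeFun (p : ℕ) (i : ZMod p) (x : ℝ × ℝ) : ℝ := edgeLin p i x + edgeConst p i

theorem edgeFun_parabolaPt_of_ne {p : ℕ} {i : ZMod p} (hi : i ≠ 0) (k : ZMod p) :
    edgeFun p i (parabolaPt p k) =
      ((k.val : ℝ) - i.val) * ((k.val : ℝ) + 1 - i.val) := by
  simp [edgeFun, edgeLin, edgeConst, parabolaPt, hi]
  ring

theorem edgeFun_zero_parabolaPt (p : ℕ) (k : ZMod p) :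
    edgeFun p 0 (parabolaPt p k) = (k.val : ℝ) * ((p : ℝ) - 1 - k.val) := by
  simp [edgeFun, edgeLin, edgeConst, parabolaPt]
  ring

theorem edgeFun_parabolaPt_nonneg {p : ℕ} [NeZero p] (i k : ZMod p) :
    0 ≤ edgeFun p i (parabolaPt p k) := by
  by_cases hi : i = 0
  · subst hi
    rw [edgeFun_zero_parabolaPt]
    have h : (k.val : ℝ) + 1 ≤ p := by exact_mod_cast ZMod.val_lt k
    exact mul_nonneg (by positivity) (by linarith)
  · rw [edgeFun_parabolaPt_of_ne hi]
    rcases lt_or_ge k.val i.val with h | h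
    · have h' : (k.val : ℝ) + 1 ≤ i.val := by exact_mod_cast h
      exact mul_nonneg_of_nonpos_of_nonpos (by linarith) (by linarith)
    · have h' : (i.val : ℝ) ≤ k.val := by exact_mod_cast h
      exact mul_nonneg (by linarith) (by linarith)

theorem edgeFun_parabolaPt_eq_zero_iff {p : ℕ} [NeZero p] (hp : 3 ≤ p) (i k : ZMod p) :
    edgeFun p i (parabolaPt p k) = 0 ↔ i = k ∨ i = k + 1 := by
  have : Fact (1 < p) := ⟨by omega⟩
  have hk := ZMod.val_lt k
  have hsucc : (k + 1).val = (k.val + 1) % p := by rw [ZMod.val_add, ZMod.val_one]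
  have hi' := ZMod.val_lt i
  rw [← (ZMod.val_injective p).eq_iff, ← (ZMod.val_injective p).eq_iff, hsucc]
  by_cases hi : i = 0
  · subst hi
    rw [edgeFun_zero_parabolaPt, mul_eq_zero, ZMod.val_zero]
    have h1 : ((k.val : ℝ) = 0) ↔ 0 = k.val := by rw [Nat.cast_eq_zero, eq_comm]
    have h2 : ((p : ℝ) - 1 - k.val = 0) ↔ 0 = (k.val + 1) % p := by
      have : ((p : ℝ) - 1 - k.val = 0) ↔ k.val + 1 = p := by
        rw [← Nat.cast_inj (R := ℝ)]
        push_cast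
        constructor <;> intro h <;> linarith
      rw [this]
      constructor
      · intro h
        simp [h]
      · intro h
        by_contra hne
        rw [Nat.mod_eq_of_lt (by omega)] at h
        omega
    rw [h1, h2]
  · have hi0 : i.val ≠ 0 := by rwa [Ne, ZMod.val_eq_zero]
    rw [edgeFun_parabolaPt_of_ne hi, mul_eq_zero, sub_eq_zero, sub_eq_zero]
    norm_cast
    refine or_congr eq_comm ?_
    rcases Nat.lt_or_ge (k.val + 1) p with h | h
    · rw [Nat.mod_eq_of_lt h, eq_comm]
    · have : k.val + 1 = p := by omega
      rw [this, Nat.mod_self]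
      omega

theorem parabolaPt_injective {p : ℕ} [NeZero p] : Function.Injective (parabolaPt p) := by
  intro k k' h
  have h1 : (k.val : ℝ) = k'.val := congrArg Prod.fst h
  exact ZMod.val_injective p (by exact_mod_cast h1)

theorem edgeFun_combo {p : ℕ} (i : ZMod p) (x y : ℝ × ℝ) {a b : ℝ} (hab : a + b = 1) :
    edgeFun p i (a • x + b • y) = a * edgeFun p i x + b * edgeFun p i y := by
  simp only [edgeFun, map_add, map_smul, smul_eq_mul]
  linear_combination -edgeConst p i * hab

theorem mem_convexHull_of_edgeFun_eq_zero {p : ℕ} [NeZero p] (D : Set (ZMod p)) {x : ℝ × ℝ}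
    (hx : x ∈ convexHull ℝ (range (parabolaPt p))) (h0 : ∀ i ∈ D, edgeFun p i x = 0) :
    x ∈ convexHull ℝ (parabolaPt p '' {k | ∀ i ∈ D, edgeFun p i (parabolaPt p k) = 0}) := by
  set T := convexHull ℝ (parabolaPt p '' {k | ∀ i ∈ D, edgeFun p i (parabolaPt p k) = 0})
  have hsub : convexHull ℝ (range (parabolaPt p)) ⊆
      {x | (∀ i, 0 ≤ edgeFun p i x) ∧ ((∀ i ∈ D, edgeFun p i x = 0) → x ∈ T)} := by
    apply convexHull_min
    · rintro _ ⟨k, rfl⟩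
      exact ⟨fun i => edgeFun_parabolaPt_nonneg i k, fun h => subset_convexHull _ _ ⟨k, h, rfl⟩⟩
    · rw [convex_iff_forall_pos]
      rintro x ⟨hx, hx'⟩ y ⟨hy, hy'⟩ a b ha hb hab
      refine ⟨fun i => ?_, fun h => ?_⟩
      · rw [edgeFun_combo i x y hab]
        have := hx i
        have := hy i
        positivity
      · have key : ∀ i ∈ D, edgeFun p i x = 0 ∧ edgeFun p i y = 0 := by
          intro i hi
          have h1 := h i hi
          rw [edgeFun_combo i x y hab] at h1
          have h2 := mul_nonneg ha.le (hx i)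
          have h3 := mul_nonneg hb.le (hy i)
          constructor
          · exact (mul_eq_zero.mp (by linarith : a * edgeFun p i x = 0)).resolve_left ha.ne'
          · exact (mul_eq_zero.mp (by linarith : b * edgeFun p i y = 0)).resolve_left hb.ne'
        exact convex_convexHull ℝ _ (hx' fun i hi => (key i hi).1) (hy' fun i hi => (key i hi).2)
          ha.le hb.le hab
  exact (hsub hx).2 h0

theorem parabolaPt_notMem_convexHull {p : ℕ} [NeZero p] (k : ZMod p) :
    parabolaPt p k ∉ convexHull ℝ (range (parabolaPt p) \ {parabolaPt p k}) := by
  intro hk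
  have hsub : convexHull ℝ (range (parabolaPt p) \ {parabolaPt p k}) ⊆
      {x | -(k.val : ℝ) ^ 2 < x.2 - 2 * k.val * x.1} := by
    apply convexHull_min
    · rintro _ ⟨⟨m, rfl⟩, hm⟩
      have hne : (m.val : ℝ) - k.val ≠ 0 := by
        intro h
        apply hm
        have : m.val = k.val := by exact_mod_cast sub_eq_zero.mp h
        rw [ZMod.val_injective p this]
        rfl
      have := sq_pos_of_ne_zero hne
      simp only [parabolaPt, mem_ofPred_eq]
      nlinarith
    · apply convex_halfSpace_gt
      constructor
      · intro x y
        simp only [Prod.snd_add, Prod.fst_add]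
        ring
      · intro c x
        simp only [Prod.smul_snd, Prod.smul_fst, smul_eq_mul]
        ring
  have := hsub hk
  simp only [parabolaPt, mem_ofPred_eq] at this
  nlinarith

theorem affineSpan_range_parabolaPt {p : ℕ} [NeZero p] (hp : 3 ≤ p) :
    affineSpan ℝ (range (parabolaPt p)) = ⊤ := by
  have hpt : ∀ n : ℕ, n < p →
      (((n : ℝ), (n : ℝ) ^ 2) : ℝ × ℝ) ∈ affineSpan ℝ (range (parabolaPt p)) := by
    intro n hn
    apply subset_affineSpan
    exact ⟨(n : ZMod p), by simp [parabolaPt, ZMod.val_cast_of_lt hn]⟩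
  have h0 := hpt 0 (by omega)
  have h1 := hpt 1 (by omega)
  have h2 := hpt 2 (by omega)
  rw [← AffineSubspace.direction_eq_top_iff_of_nonempty ⟨_, h0⟩, eq_top_iff]
  intro x _
  have d1 := AffineSubspace.vsub_mem_direction h1 h0
  have d2 := AffineSubspace.vsub_mem_direction h2 h0
  have hx : x = (2 * x.1 - x.2) • (((1 : ℕ) : ℝ), ((1 : ℕ) : ℝ) ^ 2) +
      ((x.2 - x.1) / 2) • (((2 : ℕ) : ℝ), ((2 : ℕ) : ℝ) ^ 2) := by
    ext <;> simp <;> ring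
  rw [hx]
  refine Submodule.add_mem _ (Submodule.smul_mem _ _ ?_) (Submodule.smul_mem _ _ ?_)
  · simpa using d1
  · simpa using d2

open Classical in
/-- Linear part of the parametrization of the face `jv` of the wedge product. -/
def faceLin (p q : ℕ) (jv : ZMod p → ZMod q) :
    ℝ × ℝ →ₗ[ℝ] (ℝ × ℝ) × (ZMod p → ZMod q → ℝ) :=
  LinearMap.id.prod
    (LinearMap.pi fun i => LinearMap.pi fun j => if j = jv i then edgeLin p i else 0)

open Classical in
/-- Constant part of the parametrization of the face `jv` of the wedge product. -/
def faceConst (p q : ℕ) (jv : ZMod p → ZMod q) : (ℝ × ℝ) × (ZMod p → ZMod q → ℝ) :=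
  (0, fun i j => if j = jv i then edgeConst p i else 0)

/-- The plane of the face `jv` of the wedge product, parametrized by the plane of the `p`-gon. -/
def faceMap (p q : ℕ) (jv : ZMod p → ZMod q) :
    ℝ × ℝ →ᵃ[ℝ] (ℝ × ℝ) × (ZMod p → ZMod q → ℝ) :=
  (faceLin p q jv).toAffineMap + AffineMap.const ℝ _ (faceConst p q jv)

theorem faceMap_apply {p q : ℕ} (jv : ZMod p → ZMod q) (x : ℝ × ℝ) :
    faceMap p q jv x = faceLin p q jv x + faceConst p q jv := rfl

open Classical in
theorem faceMap_eq {p q : ℕ} (jv : ZMod p → ZMod q) (x : ℝ × ℝ) :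
    faceMap p q jv x = (x, fun i j => if j = jv i then edgeFun p i x else 0) := by
  rw [faceMap_apply]
  ext i
  · simp [faceLin, faceConst]
  · simp [faceLin, faceConst]
  · rename_i j
    by_cases h : j = jv i <;> simp [faceLin, faceConst, edgeFun, h]

theorem faceMap_eq_faceMap_iff {p q : ℕ} (jv jv' : ZMod p → ZMod q) (x y : ℝ × ℝ) :
    faceMap p q jv x = faceMap p q jv' y ↔ x = y ∧ ∀ i, jv i ≠ jv' i → edgeFun p i x = 0 := by
  rw [faceMap_eq, faceMap_eq, Prod.mk.injEq]
  constructor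
  · rintro ⟨rfl, h⟩
    refine ⟨rfl, fun i hi => ?_⟩
    simpa [hi] using congrFun (congrFun h i) (jv i)
  · rintro ⟨rfl, h⟩
    refine ⟨rfl, ?_⟩
    ext i j
    by_cases hi : jv i = jv' i
    · rw [hi]
    · simp [h i hi]

/-- A linear map to `ℝ⁵` that is injective on the union of any two faces of the wedge product. -/
theorem exists_projection_faceMap (p q : ℕ) [NeZero p] [NeZero q] :
    ∃ f : (ℝ × ℝ) × (ZMod p → ZMod q → ℝ) →ₗ[ℝ] (Fin 5 → ℝ), ∀ jv jv' x y,
      f (faceMap p q jv x) = f (faceMap p q jv' y) → faceMap p q jv x = faceMap p q jv' y := by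
  obtain ⟨f, hf⟩ := exists_linearMap_disjoint_ker
    (ι := (ZMod p → ZMod q) × (ZMod p → ZMod q)) 5 _
    (V := (ℝ × ℝ) × (ZMod p → ZMod q → ℝ)) rfl
    (fun J => (faceLin p q J.1).range ⊔ (faceLin p q J.2).range ⊔
      Submodule.span ℝ {faceConst p q J.1 - faceConst p q J.2}) (by
      rintro ⟨jv, jv'⟩
      have h1 := LinearMap.finrank_range_le (faceLin p q jv)
      have h2 := LinearMap.finrank_range_le (faceLin p q jv')
      have h3 := finrank_span_le_card (R := ℝ) {faceConst p q jv - faceConst p q jv'}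
      have h4 := Submodule.finrank_add_le_finrank_add_finrank
        (faceLin p q jv).range (faceLin p q jv').range
      have h5 := Submodule.finrank_add_le_finrank_add_finrank
        ((faceLin p q jv).range ⊔ (faceLin p q jv').range)
        (Submodule.span ℝ {faceConst p q jv - faceConst p q jv'})
      have h6 : Module.finrank ℝ (ℝ × ℝ) = 2 := by simp
      rw [toFinset_singleton, Finset.card_singleton] at h3
      dsimp only
      omega)
  refine ⟨f, fun jv jv' x y h => sub_eq_zero.mp (hf (jv, jv') _ ?_ (by rw [map_sub, h, sub_self]))⟩
  have : faceMap p q jv x - faceMap p q jv' y =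
      faceLin p q jv x + faceLin p q jv' (-y) + (faceConst p q jv - faceConst p q jv') := by
    rw [faceMap_apply, faceMap_apply, map_neg]
    abel
  rw [this]
  exact Submodule.add_mem_sup (Submodule.add_mem_sup ⟨_, rfl⟩ ⟨_, rfl⟩)
    (Submodule.mem_span_singleton_self _)

open Classical in
/-- The `k`-th vertex of the face `jv`. -/
def faceVert (p q : ℕ) (jv : ZMod p → ZMod q) (k : ZMod p) : ZMod p → Set (ZMod q) :=
  fun i => if i = k ∨ i = k + 1 then Set.univ else {jv i}ᶜ

theorem faceVert_eq_univ_iff {p q : ℕ} (jv : ZMod p → ZMod q) (k i : ZMod p) :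
    faceVert p q jv k i = Set.univ ↔ i = k ∨ i = k + 1 := by
  by_cases h : i = k ∨ i = k + 1 <;> simp [faceVert, h]

theorem faceVert_congr {p q : ℕ} {jv jv' : ZMod p → ZMod q} {k : ZMod p}
    (h : ∀ i, jv i ≠ jv' i → i = k ∨ i = k + 1) : faceVert p q jv k = faceVert p q jv' k := by
  funext i
  by_cases hi : i = k ∨ i = k + 1
  · simp [faceVert, hi]
  · have : jv i = jv' i := by
      by_contra hne
      exact hi (h i hne)
    simp [faceVert, hi, this]

theorem faceVert_eq_faceVert {p q : ℕ} (hp : 3 ≤ p) {jv jv' : ZMod p → ZMod q} {k k' : ZMod p}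
    (h : faceVert p q jv k = faceVert p q jv' k') :
    k = k' ∧ ∀ i, jv i ≠ jv' i → i = k ∨ i = k + 1 := by
  have hU : ∀ i, (i = k ∨ i = k + 1) ↔ (i = k' ∨ i = k' + 1) := fun i => by
    rw [← faceVert_eq_univ_iff jv, ← faceVert_eq_univ_iff jv', h]
  have h2 : (2 : ZMod p) ≠ 0 := by
    intro h
    have : ((2 : ℕ) : ZMod p) = 0 := by exact_mod_cast h
    rw [ZMod.natCast_eq_zero_iff] at this
    have := Nat.le_of_dvd (by norm_num) this
    omega
  have hk : k = k' := by
    rcases (hU k).mp (Or.inl rfl) with h | h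
    · exact h
    · rcases (hU k').mpr (Or.inl rfl) with h' | h'
      · exact h'.symm
      · refine absurd ?_ h2
        linear_combination -h - h'
  subst hk
  refine ⟨rfl, fun i hi => ?_⟩
  by_contra hik
  have := congrFun h i
  simp only [faceVert, hik, if_false, compl_inj_iff, singleton_eq_singleton_iff] at this
  exact hi this

theorem isVertVec_iff {p q : ℕ} [NeZero q] (V : ZMod p → Set (ZMod q)) :
    IsVertVec p q V ↔ ∃ jv k, V = faceVert p q jv k := by
  constructor
  · rintro ⟨k, hk, hk', h⟩
    have : ∀ i, ∃ j : ZMod q, ¬ (i = k ∨ i = k + 1) → V i = {j}ᶜ := by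
      intro i
      by_cases hi : i = k ∨ i = k + 1
      · exact ⟨0, fun h => absurd hi h⟩
      · obtain ⟨j, hj⟩ := h i (fun h => hi (Or.inl h)) (fun h => hi (Or.inr h))
        exact ⟨j, fun _ => hj⟩
    choose jv hjv using this
    refine ⟨jv, k, ?_⟩
    funext i
    by_cases hi : i = k ∨ i = k + 1
    · rw [(faceVert_eq_univ_iff jv k i).mpr hi]
      rcases hi with rfl | rfl <;> assumption
    · simp [faceVert, hi, hjv i hi]
  · rintro ⟨jv, k, rfl⟩
    exact ⟨k, by simp [faceVert], by simp [faceVert],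
      fun i h1 h2 => ⟨jv i, by simp [faceVert, h1, h2]⟩⟩

theorem pgonVerts_eq_range {p q : ℕ} [NeZero q] (jv : ZMod p → ZMod q) :
    pgonVerts p q jv = range (faceVert p q jv) := by
  ext V
  simp only [pgonVerts, mem_ofPred_eq, isVertVec_iff, mem_range]
  constructor
  · rintro ⟨⟨jv', k, rfl⟩, h⟩
    refine ⟨k, faceVert_congr fun i hi => ?_⟩
    by_contra hik
    have := h i
    simp only [faceVert, hik, if_false, compl_subset_compl, singleton_subset_iff,
      mem_singleton_iff] at this
    exact hi this.symm
  · rintro ⟨k, rfl⟩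
    refine ⟨⟨jv, k, rfl⟩, fun i => ?_⟩
    by_cases hi : i = k ∨ i = k + 1 <;> simp [faceVert, hi]

/-- For all `p ≥ 3` and `q ≥ 2` the surface `Σ_{p,2q}` can be
realized as a polyhedral surface embedded in `ℝ⁵`: there is an injective placement of
its vertices in `ℝ⁵` under which every 2-face becomes a planar convex `p`-gon (each of
its vertices being an extreme point), and any two 2-faces intersect exactly in the
convex hull of their common vertices (a common subface). -/
theorem sigmaSurface_realizable_in_R5
    (p q : ℕ) [NeZero p] [NeZero q] (hp : 3 ≤ p) (hq : 2 ≤ q) :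
    ∃ φ : (ZMod p → Set (ZMod q)) → (Fin 5 → ℝ),
      Set.InjOn φ {V | IsVertVec p q V} ∧
      (∀ jv : ZMod p → ZMod q, ((∑ i, jv i) = 0 ∨ (∑ i, jv i) = 1) →
        setDim (convexHull ℝ (φ '' pgonVerts p q jv)) = 2 ∧
        (φ '' pgonVerts p q jv).ncard = p ∧
        ∀ x ∈ φ '' pgonVerts p q jv,
          x ∉ convexHull ℝ ((φ '' pgonVerts p q jv) \ {x})) ∧
      (∀ jv jv' : ZMod p → ZMod q,
        ((∑ i, jv i) = 0 ∨ (∑ i, jv i) = 1) →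
        ((∑ i, jv' i) = 0 ∨ (∑ i, jv' i) = 1) →
        convexHull ℝ (φ '' pgonVerts p q jv) ∩ convexHull ℝ (φ '' pgonVerts p q jv')
          = convexHull ℝ (φ '' (pgonVerts p q jv ∩ pgonVerts p q jv'))) := by
  obtain ⟨f, hf⟩ := exists_projection_faceMap p q
  let B : (ZMod p → ZMod q) → (ℝ × ℝ →ᵃ[ℝ] (Fin 5 → ℝ)) :=
    fun jv => f.toAffineMap.comp (faceMap p q jv)
  have hB : ∀ jv jv' x y, B jv x = B jv' y ↔
      x = y ∧ ∀ i, jv i ≠ jv' i → edgeFun p i x = 0 := by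
    intro jv jv' x y
    rw [← faceMap_eq_faceMap_iff]
    exact ⟨hf jv jv' x y, fun h => congrArg f h⟩
  have hBinj : ∀ jv, Function.Injective (B jv) := fun jv x y h => ((hB jv jv x y).mp h).1
  obtain ⟨φ, hφ⟩ : ∃ φ : (ZMod p → Set (ZMod q)) → (Fin 5 → ℝ),
      ∀ jv k, φ (faceVert p q jv k) = B jv (parabolaPt p k) := by
    have hfac : Function.FactorsThrough
        (fun a : (ZMod p → ZMod q) × ZMod p => B a.1 (parabolaPt p a.2))
        (fun a => faceVert p q a.1 a.2) := by
      rintro ⟨jv, k⟩ ⟨jv', k'⟩ h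
      obtain ⟨hk, hi⟩ := faceVert_eq_faceVert hp h
      dsimp only at hk hi ⊢
      subst hk
      exact (hB _ _ _ _).mpr
        ⟨rfl, fun i hne => (edgeFun_parabolaPt_eq_zero_iff hp i k).mpr (hi i hne)⟩
    exact ⟨Function.extend _ _ 0, fun jv k => hfac.extend_apply 0 (jv, k)⟩
  have himg : ∀ jv, φ '' pgonVerts p q jv = B jv '' range (parabolaPt p) := by
    intro jv
    rw [pgonVerts_eq_range, ← range_comp, ← range_comp]
    exact congrArg range (funext fun k => hφ jv k)
  have hhull : ∀ jv, convexHull ℝ (φ '' pgonVerts p q jv) =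
      B jv '' convexHull ℝ (range (parabolaPt p)) := by
    intro jv
    rw [himg, (B jv).image_convexHull]
  refine ⟨φ, ?_, fun jv _ => ⟨?_, ?_, ?_⟩, fun jv jv' _ _ => ?_⟩
  · intro V hV V' hV' h
    obtain ⟨jv, k, rfl⟩ := (isVertVec_iff V).mp hV
    obtain ⟨jv', k', rfl⟩ := (isVertVec_iff V').mp hV'
    rw [hφ, hφ, hB] at h
    obtain rfl := parabolaPt_injective h.1
    exact faceVert_congr fun i hi => (edgeFun_parabolaPt_eq_zero_iff hp i k).mp (h.2 i hi)
  · rw [setDim, affineSpan_convexHull, himg, ← AffineSubspace.map_span,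
      affineSpan_range_parabolaPt hp, AffineSubspace.map_direction, AffineSubspace.direction_top,
      Submodule.map_top,
      LinearMap.finrank_range_of_inj ((B jv).linear_injective_iff.mpr (hBinj jv))]
    simp
  · rw [himg, ncard_image_of_injective _ (hBinj jv), ← image_univ,
      ncard_image_of_injective _ parabolaPt_injective, ncard_univ, Nat.card_zmod]
  · rw [himg]
    rintro _ ⟨_, ⟨k, rfl⟩, rfl⟩
    rw [← image_singleton, ← image_sdiff (hBinj jv), ← (B jv).image_convexHull,
      (hBinj jv).mem_set_image]
    exact parabolaPt_notMem_convexHull k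
  · apply Subset.antisymm
    · rw [hhull, hhull]
      rintro _ ⟨⟨x, hx, rfl⟩, ⟨y, _, hxy⟩⟩
      obtain ⟨rfl, hD⟩ := (hB jv jv' x y).mp hxy.symm
      have hmem := mem_image_of_mem (B jv)
        (mem_convexHull_of_edgeFun_eq_zero {i | jv i ≠ jv' i} hx hD)
      rw [(B jv).image_convexHull] at hmem
      refine convexHull_mono ?_ hmem
      rintro _ ⟨_, ⟨k, hk, rfl⟩, rfl⟩
      rw [pgonVerts_eq_range, pgonVerts_eq_range]
      exact ⟨faceVert p q jv k, ⟨⟨k, rfl⟩, k, (faceVert_congr fun i hi =>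
        (edgeFun_parabolaPt_eq_zero_iff hp i k).mp (hk i hi)).symm⟩, hφ jv k⟩
    · exact subset_inter (convexHull_mono (image_mono inter_subset_left))
        (convexHull_mono (image_mono inter_subset_right))
end
end

section
/- Let P = {x ∈ R^d : a_i x ≤ 1, i ∈ [m]} be a polytope, F a non-empty face of P, and H_F ⊆ [m] the set of indices of the inequalities that are tight at F. Let π : R^d → R^k be the projection to the first k coordinates. Then F is preserved by π and π(F) lies on the lower hull of π(P) with respect to the coordinate x_{k−1} if and only if: (L1) the facet normals truncated to the last d−k coordinates, {a_i^{(d−k)} : i ∈ H_F}, positively span R^{d−k}, and (L2) there exist λ_i ≥ 0 (i ∈ H_F) such that ν = Σ_{i∈H_F} λ_i a_i has ν_k = ⋯ = ν_{d−1} = 0 and ν_{k−1} < 0. -/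
open Matrix Set

noncomputable section

def IsFaceOf {V : Type*} [AddCommGroup V] [Module ℝ V] (F P : Set V) : Prop :=
  F ⊆ P ∧ ∃ (c : V →ₗ[ℝ] ℝ) (b : ℝ), (∀ x ∈ P, c x ≤ b) ∧ F = {x ∈ P | c x = b}

section Polyhedra

theorem image_preimage_inter_of_subset {α β : Type*} {F : Set α} {G : Set β} {π : α → β}
    (h : G ⊆ π '' F) :
    π '' (π ⁻¹' G ∩ F) = G := by
  rw [inter_comm, image_inter_preimage, inter_eq_right.2 h]

variable {V W ι : Type*} [AddCommGroup V] [Module ℝ V] [AddCommGroup W] [Module ℝ W]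

/-- **Farkas' lemma** for finitely many linear functionals on a real vector space. -/
theorem exists_nonneg_combination_of_forall_nonpos (s : Finset ι) (f : ι → V →ₗ[ℝ] ℝ)
    (g : V →ₗ[ℝ] ℝ) (h : ∀ v, (∀ i ∈ s, f i v ≤ 0) → g v ≤ 0) :
    ∃ lam : ι → ℝ, (∀ i, 0 ≤ lam i) ∧ (∀ i, i ∉ s → lam i = 0) ∧
      ∀ v, g v = ∑ i ∈ s, lam i * f i v := by
  classical
  induction s using Finset.induction_on generalizing f g with
  | empty =>
    refine ⟨0, by simp, by simp, fun v => ?_⟩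
    have h₁ := h v (by simp)
    have h₂ := h (-v) (by simp)
    rw [map_neg] at h₂
    simp only [Finset.sum_empty]
    linarith
  | insert j s hj ih =>
    by_cases hs : ∀ v, (∀ i ∈ s, f i v ≤ 0) → g v ≤ 0
    · obtain ⟨lam, h0, hz, hsum⟩ := ih f g hs
      refine ⟨lam, h0, fun i hi => hz i fun his => hi (Finset.mem_insert_of_mem his),
        fun v => ?_⟩
      rw [Finset.sum_insert hj, hz j hj, zero_mul, zero_add, hsum]
    · push Not at hs
      obtain ⟨y, hy, hgy⟩ := hs
      have hfy : 0 < f j y := by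
        by_contra! hle
        refine hgy.not_ge (h y fun i hi => ?_)
        rcases Finset.mem_insert.1 hi with rfl | hi
        exacts [hle, hy i hi]
      set c := f j y with hc
      obtain ⟨lam, h0, hz, hsum⟩ := ih (fun i => f i - (f i y / c) • f j)
        (g - (g y / c) • f j) (by
          intro v hv
          have key := h (v - (f j v / c) • y) (by
            intro i hi
            rcases Finset.mem_insert.1 hi with rfl | hi
            · simp only [map_sub, map_smul, smul_eq_mul, ← hc]
              rw [div_mul_cancel₀ _ hfy.ne', sub_self]
            · have := hv i hi
              simp only [LinearMap.sub_apply, LinearMap.smul_apply, map_sub, map_smul,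
                smul_eq_mul] at this ⊢
              calc _ = f i v - f i y / c * f j v := by ring
                _ ≤ 0 := this)
          simp only [LinearMap.sub_apply, LinearMap.smul_apply, map_sub, map_smul,
            smul_eq_mul] at key ⊢
          calc _ = g v - f j v / c * g y := by ring
            _ ≤ 0 := key)
      have hle : ∑ i ∈ s, lam i * f i y ≤ 0 :=
        Finset.sum_nonpos fun i hi => mul_nonpos_of_nonneg_of_nonpos (h0 i) (hy i hi)
      refine ⟨fun i => if i = j then (g y - ∑ i ∈ s, lam i * f i y) / c else lam i, ?_, ?_, ?_⟩
      · intro i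
        dsimp only
        split_ifs
        · exact div_nonneg (by linarith) hfy.le
        · exact h0 i
      · intro i hi
        rw [Finset.mem_insert, not_or] at hi
        simp [hi.1, hz i hi.2]
      · intro v
        have hv := hsum v
        have hcongr : ∑ i ∈ s, (if i = j then (g y - ∑ i ∈ s, lam i * f i y) / c else lam i) * f i v
            = ∑ i ∈ s, lam i * f i v :=
          Finset.sum_congr rfl fun i hi => by rw [if_neg (ne_of_mem_of_not_mem hi hj)]
        have hexp : ∑ i ∈ s, lam i * (f i - (f i y / c) • f j) v
            = ∑ i ∈ s, lam i * f i v - (∑ i ∈ s, lam i * f i y) / c * f j v := by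
          rw [Finset.sum_div, Finset.sum_mul, ← Finset.sum_sub_distrib]
          refine Finset.sum_congr rfl fun i _ => ?_
          simp only [LinearMap.sub_apply, LinearMap.smul_apply, smul_eq_mul]
          ring
        rw [Finset.sum_insert hj]
        beta_reduce
        rw [if_pos rfl, hcongr]
        rw [hexp] at hv
        simp only [LinearMap.sub_apply, LinearMap.smul_apply, smul_eq_mul] at hv
        rw [sub_div, sub_mul]
        linarith

/-- A convex set on which finitely many functionals are at most `1` has a point at which only
those functionals attain `1` that are constantly `1` on the whole set. -/
theorem exists_mem_forall_eq_one_imp [Finite ι] (f : ι → V →ₗ[ℝ] ℝ) {G : Set V}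
    (hG : Convex ℝ G) (hne : G.Nonempty) (hle : ∀ x ∈ G, ∀ i, f i x ≤ 1) :
    ∃ x₀ ∈ G, ∀ i, f i x₀ = 1 → ∀ x ∈ G, f i x = 1 := by
  classical
  have := Fintype.ofFinite ι
  suffices H : ∀ s : Finset ι, ∃ x₀ ∈ G, ∀ i ∈ s, f i x₀ = 1 → ∀ x ∈ G, f i x = 1 by
    obtain ⟨x₀, hx₀, h⟩ := H Finset.univ
    exact ⟨x₀, hx₀, fun i => h i (Finset.mem_univ i)⟩
  intro s
  induction s using Finset.induction_on with
  | empty => exact ⟨hne.some, hne.some_mem, by simp⟩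
  | insert j s _ ih =>
    obtain ⟨x₀, hx₀, h⟩ := ih
    by_cases hj : ∀ x ∈ G, f j x = 1
    · refine ⟨x₀, hx₀, fun i hi => ?_⟩
      rcases Finset.mem_insert.1 hi with rfl | hi
      exacts [fun _ => hj, h i hi]
    · push Not at hj
      obtain ⟨y, hy, hjy⟩ := hj
      refine ⟨(1 / 2 : ℝ) • x₀ + (1 / 2 : ℝ) • y,
        hG hx₀ hy (by norm_num) (by norm_num) (by norm_num), fun i hi hi1 => ?_⟩
      simp only [map_add, map_smul, smul_eq_mul] at hi1
      have h₁ := hle x₀ hx₀ i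
      have h₂ := hle y hy i
      rcases Finset.mem_insert.1 hi with rfl | hi
      · exact absurd (by linarith) hjy
      · exact h i hi (by linarith)

/-- A direction that does not increase the tight inequalities is feasible for a short time. -/
theorem exists_pos_forall_add_smul_le_one [Finite ι] (f : ι → V →ₗ[ℝ] ℝ) {x v : V}
    (hx : ∀ i, f i x ≤ 1) (hv : ∀ i, f i x = 1 → f i v ≤ 0) :
    ∃ t : ℝ, 0 < t ∧ ∀ i, f i (x + t • v) ≤ 1 := by
  have key : ∀ᶠ t : ℝ in nhdsWithin 0 (Ioi 0), ∀ i, f i (x + t • v) ≤ 1 := by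
    refine Filter.eventually_all.2 fun i => ?_
    simp only [map_add, map_smul, smul_eq_mul]
    rcases (hx i).lt_or_eq with hlt | heq
    · have hcont : Continuous fun t : ℝ => f i x + t * f i v := by fun_prop
      have := hcont.continuousAt (x := 0) |>.eventually_lt
        (continuousAt_const (y := (1 : ℝ))) (by simpa using hlt)
      exact (this.filter_mono nhdsWithin_le_nhds).mono fun t ht => ht.le
    · filter_upwards [self_mem_nhdsWithin] with t ht
      have := mul_nonpos_of_nonneg_of_nonpos (le_of_lt ht) (hv i heq)
      linarith
  obtain ⟨t, ht, ht0⟩ := (key.and self_mem_nhdsWithin).exists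
  exact ⟨t, ht0, ht⟩

/-- Moving along a direction that increases some functional, one reaches the boundary. -/
theorem exists_add_smul_eq_one [Finite ι] (f : ι → V →ₗ[ℝ] ℝ) {x v : V}
    (hx : ∀ i, f i x ≤ 1) (hv : ∃ i, 0 < f i v) :
    ∃ t : ℝ, (∀ i, f i (x + t • v) ≤ 1) ∧ ∃ i, 0 < f i v ∧ f i (x + t • v) = 1 := by
  classical
  have := Fintype.ofFinite ι
  obtain ⟨i, hi, hmin⟩ := Finset.exists_min_image (Finset.univ.filter fun i => 0 < f i v)
    (fun i => (1 - f i x) / f i v) (by simpa [Finset.filter_nonempty_iff] using hv)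
  have hi : 0 < f i v := (Finset.mem_filter.1 hi).2
  have ht : 0 ≤ (1 - f i x) / f i v := div_nonneg (by linarith [hx i]) hi.le
  refine ⟨(1 - f i x) / f i v, fun j => ?_, i, hi, ?_⟩
  · simp only [map_add, map_smul, smul_eq_mul]
    rcases le_or_gt (f j v) 0 with hj | hj
    · linarith [hx j, mul_nonpos_of_nonneg_of_nonpos ht hj]
    · have := (le_div_iff₀ hj).1 (hmin j (by simpa using hj))
      linarith
  · simp only [map_add, map_smul, smul_eq_mul]
    rw [div_mul_cancel₀ _ hi.ne']
    ring

theorem IsFaceOf.convex {F P : Set V} (h : IsFaceOf F P) (hP : Convex ℝ P) : Convex ℝ F := by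
  obtain ⟨-, c, b, -, rfl⟩ := h
  exact hP.inter (convex_hyperplane c.isLinear b)

/-- The face cut out of `{x | ∀ i, f i x ≤ 1}` by making the inequalities in `S` tight. -/
def tightFace (f : ι → V →ₗ[ℝ] ℝ) (S : Set ι) : Set V :=
  {x | (∀ i, f i x ≤ 1) ∧ ∀ i ∈ S, f i x = 1}

theorem convex_tightFace (f : ι → V →ₗ[ℝ] ℝ) (S : Set ι) : Convex ℝ (tightFace f S) := by
  rintro x ⟨hx, hx'⟩ y ⟨hy, hy'⟩ p q hp hq hpq
  refine ⟨fun i => ?_, fun i hi => ?_⟩ <;> simp only [map_add, map_smul, smul_eq_mul]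
  · nlinarith [mul_le_mul_of_nonneg_left (hx i) hp, mul_le_mul_of_nonneg_left (hy i) hq]
  · rw [hx' i hi, hy' i hi, mul_one, mul_one, hpq]

/-- A nonempty face of a polyhedron is cut out by the inequalities that are tight on it. -/
theorem IsFaceOf.eq_tightFace [Finite ι] {f : ι → V →ₗ[ℝ] ℝ} {S : Set ι} {G : Set V}
    (hG : IsFaceOf G (tightFace f S)) (hne : G.Nonempty) :
    G = tightFace f {i | ∀ x ∈ G, f i x = 1} := by
  obtain ⟨x₀, hx₀, hrel⟩ := exists_mem_forall_eq_one_imp f (hG.convex (convex_tightFace f S)) hne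
    fun x hx => (hG.1 hx).1
  obtain ⟨hsub, c, b, hle, hGeq⟩ := hG
  refine Subset.antisymm (fun x hx => ⟨(hsub hx).1, fun i hi => hi x hx⟩) ?_
  rintro y ⟨hy, hyt⟩
  have htight : ∀ i ∈ S, f i y = 1 := fun i hi => hyt i fun x hx => (hsub hx).2 i hi
  obtain ⟨t, ht, hfeas⟩ := exists_pos_forall_add_smul_le_one f (x := x₀) (v := x₀ - y)
    (hsub hx₀).1 fun i hi => by rw [map_sub, hi, hyt i (hrel i hi), sub_self]
  have hcb : c x₀ = b := (hGeq ▸ hx₀).2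
  have hct := hle (x₀ + t • (x₀ - y)) ⟨hfeas, fun i hi => by
    simp [(hsub hx₀).2 i hi, htight i hi]⟩
  simp only [map_add, map_smul, map_sub, smul_eq_mul, hcb] at hct
  rw [hGeq]
  refine ⟨⟨hy, htight⟩, le_antisymm (hle y ⟨hy, htight⟩) ?_⟩
  by_contra! hlt
  nlinarith [mul_pos ht (sub_pos.2 hlt)]

theorem finite_faces_tightFace [Finite ι] (f : ι → V →ₗ[ℝ] ℝ) (S : Set ι) :
    Finite {G // IsFaceOf G (tightFace f S)} := by
  refine ((finite_range (tightFace f)).insert ∅).subset fun G hG => ?_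
  rcases G.eq_empty_or_nonempty with rfl | hne
  · exact mem_insert _ _
  · exact mem_insert_of_mem _ ⟨_, (IsFaceOf.eq_tightFace hG hne).symm⟩

theorem IsFaceOf.preimage_inter {F : Set V} {G : Set W} (π : V →ₗ[ℝ] W)
    (hG : IsFaceOf G (π '' F)) : IsFaceOf (π ⁻¹' G ∩ F) F := by
  obtain ⟨-, c, b, hle, rfl⟩ := hG
  refine ⟨inter_subset_right, c ∘ₗ π, b, fun x hx => hle _ (mem_image_of_mem π hx), ?_⟩
  ext x
  constructor
  · rintro ⟨⟨-, h⟩, hx⟩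
    exact ⟨hx, h⟩
  · rintro ⟨hx, h⟩
    exact ⟨⟨mem_image_of_mem π hx, h⟩, hx⟩

/-- If a polyhedral face and its image have isomorphic face lattices, then every face of it is
the full preimage of a face of the image. -/
theorem exists_eq_preimage_inter_of_equiv {F : Set V} (π : V →ₗ[ℝ] W)
    [Finite {G // IsFaceOf G F}]
    (e : {G // IsFaceOf G F} ≃ {G // IsFaceOf G (π '' F)}) {G : Set V} (hG : IsFaceOf G F) :
    ∃ G' : Set W, G = π ⁻¹' G' ∩ F := by
  let Φ : {G // IsFaceOf G (π '' F)} → {G // IsFaceOf G F} :=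
    fun G => ⟨π ⁻¹' G.1 ∩ F, G.2.preimage_inter π⟩
  have := Finite.of_equiv _ e
  have hinj : Function.Injective Φ := by
    intro G₁ G₂ h
    have h' := congrArg (π '' ·) (congrArg Subtype.val h)
    simp only [Φ, image_preimage_inter_of_subset G₁.2.1,
      image_preimage_inter_of_subset G₂.2.1] at h'
    exact Subtype.ext h'
  obtain ⟨G', hG'⟩ := (Finite.injective_iff_surjective_of_equiv e.symm).1 hinj ⟨G, hG⟩
  exact ⟨G'.1, (congrArg Subtype.val hG').symm⟩

/-- No direction in the kernel of a projection that preserves a polyhedral face is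
nonincreasing for the tight inequalities and increasing for some other inequality. -/
theorem forall_le_zero_of_preserved [Finite ι] (f : ι → V →ₗ[ℝ] ℝ) (π : V →ₗ[ℝ] W) {S : Set ι}
    (hne : (tightFace f S).Nonempty)
    (e : {G // IsFaceOf G (tightFace f S)} ≃ {G // IsFaceOf G (π '' tightFace f S)})
    (hpre : π ⁻¹' (π '' tightFace f S) ∩ {x | ∀ i, f i x ≤ 1} = tightFace f S)
    {v : V} (hπv : π v = 0)
    (hv : ∀ i, (∀ x ∈ tightFace f S, f i x = 1) → f i v ≤ 0) (i : ι) : f i v ≤ 0 := by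
  by_contra! hi
  obtain ⟨x₀, hx₀, hrel⟩ := exists_mem_forall_eq_one_imp f (convex_tightFace f S) hne
    fun x hx => hx.1
  obtain ⟨t, hfeas, j, hj, hjt⟩ := exists_add_smul_eq_one f (v := v) hx₀.1 ⟨i, hi⟩
  have hπt : π (x₀ + t • v) = π x₀ := by simp [hπv]
  have hmem : x₀ + t • v ∈ tightFace f S := by
    rw [← hpre]
    exact ⟨⟨x₀, hx₀, hπt.symm⟩, hfeas⟩
  have hface : IsFaceOf {x ∈ tightFace f S | f j x = 1} (tightFace f S) :=
    ⟨sep_subset _ _, f j, 1, fun x hx => hx.1 j, rfl⟩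
  have := finite_faces_tightFace f S
  obtain ⟨G', hG'⟩ := exists_eq_preimage_inter_of_equiv π e hface
  have h₁ : x₀ + t • v ∈ π ⁻¹' G' ∩ tightFace f S := hG' ▸ ⟨hmem, hjt⟩
  have h₂ : x₀ ∈ π ⁻¹' G' ∩ tightFace f S := ⟨by simpa only [mem_preimage, hπt] using h₁.1, hx₀⟩
  rw [← hG'] at h₂
  exact hj.not_ge (hv j (hrel j h₂.2))

/-- If every functional on `F` factors affinely through `π`, then `π` induces an isomorphism of
face lattices. -/
theorem nonempty_orderIso_of_factor {F : Set V} (π : V →ₗ[ℝ] W) (hinj : InjOn π F)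
    (hfac : ∀ g : V →ₗ[ℝ] ℝ, ∃ (h : W →ₗ[ℝ] ℝ) (r : ℝ), ∀ x ∈ F, g x = h (π x) + r) :
    Nonempty ({G // IsFaceOf G F} ≃o {G // IsFaceOf G (π '' F)}) := by
  have himage : ∀ G, IsFaceOf G F → IsFaceOf (π '' G) (π '' F) := by
    rintro _ ⟨-, c, b, hle, rfl⟩
    obtain ⟨h, r, hc⟩ := hfac c
    refine ⟨image_mono (sep_subset _ _), h, b - r, ?_, ?_⟩
    · rintro _ ⟨x, hx, rfl⟩
      linarith [hle x hx, hc x hx]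
    · ext z
      constructor
      · rintro ⟨x, ⟨hx, hxb⟩, rfl⟩
        exact ⟨mem_image_of_mem π hx, by linarith [hc x hx]⟩
      · rintro ⟨⟨x, hx, rfl⟩, hz⟩
        exact ⟨x, ⟨hx, by linarith [hc x hx]⟩, rfl⟩
  refine ⟨⟨⟨fun G => ⟨π '' G.1, himage G.1 G.2⟩,
    fun G => ⟨π ⁻¹' G.1 ∩ F, G.2.preimage_inter π⟩, fun G => ?_, fun G => ?_⟩, ?_⟩⟩
  · exact Subtype.ext (hinj.preimage_image_inter G.2.1)
  · exact Subtype.ext (image_preimage_inter_of_subset G.2.1)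
  · intro G₁ G₂
    exact hinj.image_subset_image_iff G₁.2.1 G₂.2.1

end Polyhedra

section Coordinates

theorem add_val_lt {d k : ℕ} (l : Fin (d - k)) : k + (l : ℕ) < d :=
  Nat.add_lt_of_lt_sub' l.isLt

theorem dotProduct_eq_add_of_le {d k : ℕ} (hkd : k ≤ d) (x y : Fin d → ℝ) :
    x ⬝ᵥ y = (∑ l : Fin k, x (Fin.castLE hkd l) * y (Fin.castLE hkd l)) +
      ∑ l : Fin (d - k), x ⟨k + (l : ℕ), add_val_lt l⟩ * y ⟨k + (l : ℕ), add_val_lt l⟩ := by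
  obtain ⟨n, hn⟩ : ∃ n, d - k = n := ⟨_, rfl⟩
  obtain rfl : d = k + n := by omega
  have hsum : ∀ (n' : ℕ) (h : n = n') (z : Fin (k + n) → ℝ),
      ∑ l : Fin n, z (Fin.natAdd k l) = ∑ l : Fin n', z ⟨k + (l : ℕ), by omega⟩ := by
    rintro _ rfl z
    rfl
  rw [← hsum (k + n - k) hn.symm fun j => x j * y j]
  exact Fin.sum_univ_add _

theorem sum_mul_dotProduct {m n : Type*} [Fintype m] [Fintype n] (lam : m → ℝ) (a : m → n → ℝ)
    (x : n → ℝ) : ∑ i, lam i * (a i ⬝ᵥ x) = (fun j => ∑ i, lam i * a i j) ⬝ᵥ x := by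
  simp only [dotProduct, Finset.mul_sum, Finset.sum_mul, mul_assoc]
  exact Finset.sum_comm

theorem sum_mul_dotProduct_eq_add {m d k : ℕ} (hkd : k ≤ d) (lam : Fin m → ℝ)
    (a : Fin m → Fin d → ℝ) (x : Fin d → ℝ) :
    ∑ i, lam i * (a i ⬝ᵥ x) =
      (fun l : Fin k => ∑ i, lam i * a i (Fin.castLE hkd l)) ⬝ᵥ (fun l => x (Fin.castLE hkd l)) +
      ∑ l : Fin (d - k), (∑ i, lam i * a i ⟨k + (l : ℕ), add_val_lt l⟩) * x ⟨k + (l : ℕ), add_val_lt l⟩ := by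
  rw [sum_mul_dotProduct, dotProduct_eq_add_of_le hkd]
  rfl

theorem sum_mul_eq_sum_of_tight {ι : Type*} [Fintype ι] {S : Set ι} {lam r : ι → ℝ}
    (hz : ∀ i, i ∉ S → lam i = 0) (hr : ∀ i ∈ S, r i = 1) : ∑ i, lam i * r i = ∑ i, lam i := by
  refine Finset.sum_congr rfl fun i _ => ?_
  by_cases hi : i ∈ S
  · rw [hr i hi, mul_one]
  · rw [hz i hi, zero_mul]

/-- A bounded set contains no ray. -/
theorem eq_zero_of_forall_add_smul_mem {E : Type*} [NormedAddCommGroup E] [NormedSpace ℝ E]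
    {P : Set E} (hP : Bornology.IsBounded P) {x v : E}
    (h : ∀ t : ℝ, 0 ≤ t → x + t • v ∈ P) : v = 0 := by
  obtain ⟨R, hR⟩ := hP.exists_norm_le
  by_contra hv
  have hv : 0 < ‖v‖ := norm_pos_iff.2 hv
  have hx : ‖x‖ ≤ R := hR x (by simpa using h 0 le_rfl)
  have hR0 : 0 ≤ R := (norm_nonneg x).trans hx
  have ht : 0 ≤ (2 * R + 1) / ‖v‖ := by positivity
  have h₁ := norm_sub_le (x + ((2 * R + 1) / ‖v‖) • v) x
  rw [add_sub_cancel_left, norm_smul, Real.norm_of_nonneg ht, div_mul_cancel₀ _ hv.ne'] at h₁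
  linarith [hR _ (h _ ht)]

/-- A linear functional that is maximal over a polyhedron on the whole of a face is a nonnegative
combination of the inequalities tight at that face. -/
theorem exists_nonneg_combination_of_isMaxOn {V ι : Type*} [AddCommGroup V] [Module ℝ V]
    [Fintype ι] (f : ι → V →ₗ[ℝ] ℝ) {S : Set ι} (hne : (tightFace f S).Nonempty)
    (g : V →ₗ[ℝ] ℝ) {β : ℝ} (hle : ∀ x, (∀ i, f i x ≤ 1) → g x ≤ β)
    (heq : ∀ x ∈ tightFace f S, g x = β) :
    ∃ lam : ι → ℝ, (∀ i, 0 ≤ lam i) ∧ (∀ i, i ∉ {i | ∀ x ∈ tightFace f S, f i x = 1} → lam i = 0) ∧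
      ∀ v, g v = ∑ i, lam i * f i v := by
  classical
  obtain ⟨x₀, hx₀, hrel⟩ := exists_mem_forall_eq_one_imp f (convex_tightFace f S) hne
    fun x hx => hx.1
  obtain ⟨lam, h0, hz, hsum⟩ := exists_nonneg_combination_of_forall_nonpos
    (Finset.univ.filter fun i => ∀ x ∈ tightFace f S, f i x = 1) f g (by
      intro v hv
      obtain ⟨t, ht, hfeas⟩ := exists_pos_forall_add_smul_le_one f hx₀.1
        (v := v) fun i hi => hv i (by simpa using hrel i hi)
      have := hle _ hfeas
      rw [map_add, map_smul, smul_eq_mul, heq x₀ hx₀] at this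
      by_contra! hpos
      linarith [mul_pos ht hpos])
  refine ⟨lam, h0, fun i hi => hz i (by simpa using hi), fun v => ?_⟩
  rw [hsum v]
  refine Finset.sum_subset (Finset.filter_subset _ _) fun i _ hi => ?_
  rw [hz i hi, zero_mul]

/-- Facet normals of a preserved face positively span the fibre of the projection. -/
theorem positively_span_of_preserved {d k m : ℕ} (hkd : k ≤ d) (a : Fin m → Fin d → ℝ)
    (hbd : Bornology.IsBounded {x : Fin d → ℝ | ∀ i, a i ⬝ᵥ x ≤ 1}) {S : Set (Fin m)}
    (hne : (tightFace (fun i => dotProductBilin ℝ ℝ (a i)) S).Nonempty)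
    (e : {G // IsFaceOf G (tightFace (fun i => dotProductBilin ℝ ℝ (a i)) S)} ≃
      {G // IsFaceOf G (LinearMap.funLeft ℝ ℝ (Fin.castLE hkd) ''
        tightFace (fun i => dotProductBilin ℝ ℝ (a i)) S)})
    (hpre : LinearMap.funLeft ℝ ℝ (Fin.castLE hkd) ⁻¹' (LinearMap.funLeft ℝ ℝ (Fin.castLE hkd) ''
        tightFace (fun i => dotProductBilin ℝ ℝ (a i)) S) ∩ {x | ∀ i, a i ⬝ᵥ x ≤ 1} =
      tightFace (fun i => dotProductBilin ℝ ℝ (a i)) S)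
    (u : Fin (d - k) → ℝ) :
    ∃ lam : Fin m → ℝ, (∀ i, 0 ≤ lam i) ∧
      (∀ i, i ∉ {i | ∀ x ∈ tightFace (fun i => dotProductBilin ℝ ℝ (a i)) S, a i ⬝ᵥ x = 1} →
        lam i = 0) ∧
      ∀ l : Fin (d - k), ∑ i, lam i * a i ⟨k + (l : ℕ), add_val_lt l⟩ = u l := by
  classical
  set f : Fin m → (Fin d → ℝ) →ₗ[ℝ] ℝ := fun i => dotProductBilin ℝ ℝ (a i) with hf
  let f' : Fin m → (Fin (d - k) → ℝ) →ₗ[ℝ] ℝ := fun i =>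
    dotProductBilin ℝ ℝ fun l : Fin (d - k) => a i ⟨k + (l : ℕ), add_val_lt l⟩
  obtain ⟨lam, h0, hz, hsum⟩ := exists_nonneg_combination_of_forall_nonpos
    (Finset.univ.filter fun i => ∀ x ∈ tightFace f S, f i x = 1) f' (dotProductBilin ℝ ℝ u) (by
      intro w hw
      let v : Fin d → ℝ := fun j => if h : k ≤ (j : ℕ) then w ⟨j - k, by omega⟩ else 0
      have hvw : ∀ l : Fin (d - k), v ⟨k + (l : ℕ), add_val_lt l⟩ = w l := fun l => by simp [v]
      have hπv : LinearMap.funLeft ℝ ℝ (Fin.castLE hkd) v = 0 := by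
        ext l
        simp [v, LinearMap.funLeft_apply]
      have hfv : ∀ i, f i v = f' i w := by
        intro i
        have hzero : ∀ l : Fin k, v (Fin.castLE hkd l) = 0 := congrFun hπv
        change a i ⬝ᵥ v = _
        rw [dotProduct_eq_add_of_le hkd]
        simp only [hvw, hzero, mul_zero, Finset.sum_const_zero, zero_add]
        rfl
      have hnonpos := forall_le_zero_of_preserved f _ hne e hpre hπv fun i hi => by
        rw [hfv]
        exact hw i (by simpa using hi)
      obtain ⟨x₀, hx₀⟩ := hne
      have hv : v = 0 := eq_zero_of_forall_add_smul_mem hbd (x := x₀) fun t ht i => by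
        have h₁ : f i (x₀ + t • v) = f i x₀ + t * f i v := by simp
        have h₂ : f i (x₀ + t • v) ≤ 1 := by
          rw [h₁]
          linarith [hx₀.1 i, mul_nonpos_of_nonneg_of_nonpos ht (hnonpos i)]
        exact h₂
      have hw0 : w = 0 := by
        ext l
        rw [← hvw, hv]
        rfl
      rw [hw0, map_zero])
  refine ⟨lam, h0, fun i hi => hz i (by simpa [hf] using hi), fun l => ?_⟩
  have h₁ : u l = ∑ i ∈ Finset.univ.filter (fun i => ∀ x ∈ tightFace f S, f i x = 1),
      lam i * a i ⟨k + (l : ℕ), add_val_lt l⟩ := by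
    simpa [f', dotProductBilin] using hsum (Pi.single l 1)
  rw [h₁]
  refine (Finset.sum_subset (Finset.filter_subset _ _) fun i _ hi => ?_).symm
  rw [hz i hi, zero_mul]

/-- If the truncated normals positively span, every functional factors on the face through the
projection. -/
theorem exists_factor_of_positively_span {d k m : ℕ} (hkd : k ≤ d) (a : Fin m → Fin d → ℝ)
    {S : Set (Fin m)} {F : Set (Fin d → ℝ)} (hF : ∀ x ∈ F, ∀ i ∈ S, a i ⬝ᵥ x = 1)
    (hspan : ∀ u : Fin (d - k) → ℝ, ∃ lam : Fin m → ℝ,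
      (∀ i, 0 ≤ lam i) ∧ (∀ i, i ∉ S → lam i = 0) ∧
      ∀ l : Fin (d - k), ∑ i, lam i * a i ⟨k + (l : ℕ), add_val_lt l⟩ = u l)
    (g : (Fin d → ℝ) →ₗ[ℝ] ℝ) :
    ∃ (h : (Fin k → ℝ) →ₗ[ℝ] ℝ) (r : ℝ), ∀ x ∈ F,
      g x = h (LinearMap.funLeft ℝ ℝ (Fin.castLE hkd) x) + r := by
  obtain ⟨q, rfl⟩ := (dotProductEquiv ℝ (Fin d)).surjective g
  obtain ⟨lam, -, hz, hlam⟩ := hspan fun l => q ⟨k + (l : ℕ), add_val_lt l⟩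
  refine ⟨dotProductBilin ℝ ℝ ((fun l => q (Fin.castLE hkd l)) -
    fun l => ∑ i, lam i * a i (Fin.castLE hkd l)), ∑ i, lam i, fun x hx => ?_⟩
  have h₁ := sum_mul_dotProduct_eq_add hkd lam a x
  rw [sum_mul_eq_sum_of_tight hz (hF x hx)] at h₁
  simp only [hlam] at h₁
  change q ⬝ᵥ x = (_ - _) ⬝ᵥ (fun l => x (Fin.castLE hkd l)) + _
  rw [sub_dotProduct, h₁, dotProduct_eq_add_of_le hkd]
  simp only [dotProduct]
  ring

end Coordinates

/-- Preserved faces on the lower hull.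
Let `P = {x ∈ ℝ^d | a_i x ≤ 1, i ∈ [m]}` be a polytope, `F` a nonempty face of `P`,
`H_F` the set of indices of inequalities tight at `F`, and `π` the projection to the
first `k` coordinates.  Then `F` is preserved by `π` (i.e. `π(F)` is a face of `π(P)`,
combinatorially equivalent to `F`, with `π⁻¹(π(F)) ∩ P = F`) and `π(F)` lies on the
lower hull of `π(P)` with respect to `x_{k-1}` if and only if
(L1) the truncations of the `a_i`, `i ∈ H_F`, to the last `d-k` coordinates positively
span `ℝ^{d-k}`, and (L2) some nonnegative combination `ν = Σ_{i ∈ H_F} λ_i a_i` has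
`ν_k = ⋯ = ν_{d-1} = 0` and `ν_{k-1} < 0`. -/
theorem preserved_faces_on_lower_hull
    (d k m : ℕ) (hk : 1 ≤ k) (hkd : k ≤ d)
    (a : Fin m → Fin d → ℝ)
    (P : Set (Fin d → ℝ)) (hP : P = {x | ∀ i, a i ⬝ᵥ x ≤ 1})
    (hPbd : Bornology.IsBounded P)
    (F : Set (Fin d → ℝ)) (hF : IsFaceOf F P) (hFne : F.Nonempty)
    (HF : Set (Fin m)) (hHF : HF = {i | ∀ x ∈ F, a i ⬝ᵥ x = 1})
    (π : (Fin d → ℝ) → (Fin k → ℝ)) (hπ : π = fun x l => x (Fin.castLE hkd l)) :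
    -- `F` is preserved by `π` and `π(F)` lies on the lower hull w.r.t. `x_{k-1}` …
    ((IsFaceOf (π '' F) (π '' P) ∧
      Nonempty ({G // IsFaceOf G F} ≃o {G // IsFaceOf G (π '' F)}) ∧
      π ⁻¹' (π '' F) ∩ P = F) ∧
     (∃ (c : Fin k → ℝ) (β : ℝ), c ⟨k - 1, by omega⟩ < 0 ∧
        (∀ z ∈ π '' P, c ⬝ᵥ z ≤ β) ∧
        π '' F = {z ∈ π '' P | c ⬝ᵥ z = β}))
    ↔
    -- … if and only if (L1) and (L2):
    ((∀ u : Fin (d - k) → ℝ, ∃ lam : Fin m → ℝ,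
        (∀ i, 0 ≤ lam i) ∧ (∀ i, i ∉ HF → lam i = 0) ∧
        ∀ l : Fin (d - k), ∑ i, lam i * a i ⟨k + (l : ℕ), by omega⟩ = u l) ∧
     (∃ lam : Fin m → ℝ,
        (∀ i, 0 ≤ lam i) ∧ (∀ i, i ∉ HF → lam i = 0) ∧
        (∀ l : Fin (d - k), ∑ i, lam i * a i ⟨k + (l : ℕ), by omega⟩ = 0) ∧
        ∑ i, lam i * a i ⟨k - 1, by omega⟩ < 0)) := by
  classical
  set f : Fin m → (Fin d → ℝ) →ₗ[ℝ] ℝ := fun i => dotProductBilin ℝ ℝ (a i) with hf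
  set p := LinearMap.funLeft ℝ ℝ (Fin.castLE hkd) with hp
  obtain rfl : π = p := hπ
  have hPf : P = tightFace f ∅ := by
    rw [hP]
    ext x
    simp [tightFace, hf]
  have hFt : F = tightFace f HF := by
    rw [hHF]
    exact (hPf ▸ hF).eq_tightFace hFne
  constructor
  · rintro ⟨⟨-, ⟨e⟩, hpre⟩, c, β, hc, hle, heq⟩
    have hHF' : HF = {i | ∀ x ∈ tightFace f HF, f i x = 1} := by
      rw [← hFt]
      exact hHF
    have hne : (tightFace f HF).Nonempty := hFt ▸ hFne
    constructor
    · rw [hHF']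
      exact positively_span_of_preserved hkd a (hP ▸ hPbd) hne (hFt ▸ e.toEquiv)
        (by rw [← hf, ← hFt, ← hP]; exact hpre)
    · obtain ⟨lam, h0, hz, hsum⟩ := exists_nonneg_combination_of_isMaxOn f hne
        (dotProductBilin ℝ ℝ c ∘ₗ p) (β := β)
        (fun x hx => hle _ (mem_image_of_mem p (by rw [hP]; exact hx)))
        (fun x hx => by
          have : p x ∈ p '' F := mem_image_of_mem p (by rwa [hFt])
          rw [heq] at this
          exact this.2)
      have hcoord : ∀ j, c ⬝ᵥ p (Pi.single j 1) = ∑ i, lam i * a i j := fun j => by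
        simpa [hf, dotProductBilin] using hsum (Pi.single j 1)
      refine ⟨lam, h0, by rwa [← hHF'] at hz, fun l => ?_, ?_⟩
      · rw [← hcoord]
        have : p (Pi.single ⟨k + (l : ℕ), by omega⟩ 1) = 0 := by
          ext j
          rw [hp, LinearMap.funLeft_apply, Pi.single_apply, if_neg, Pi.zero_apply]
          rw [Fin.ext_iff]
          simp only [Fin.val_castLE]
          omega
        rw [this, dotProduct_zero]
      · rw [← hcoord]
        have : p (Pi.single ⟨k - 1, by omega⟩ 1) = Pi.single ⟨k - 1, by omega⟩ 1 := by
          ext j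
          simp [hp, LinearMap.funLeft_apply, Pi.single_apply, Fin.ext_iff]
        rwa [this, dotProduct_single_one]
  · rintro ⟨hspan, lam₂, h0₂, hz₂, hl₂, hneg⟩
    have htight : ∀ x ∈ F, ∀ i ∈ HF, a i ⬝ᵥ x = 1 := fun x hx i hi => by
      rw [hHF] at hi
      exact hi x hx
    have hfac := exists_factor_of_positively_span hkd a htight hspan
    have hinj : InjOn p F := by
      intro x hx y hy hxy
      ext j
      obtain ⟨h, r, hg⟩ := hfac (LinearMap.proj j)
      have h₁ := hg x hx
      have h₂ := hg y hy
      rw [← hp, hxy] at h₁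
      rw [← hp, ← h₁] at h₂
      exact h₂.symm
    obtain ⟨lam₁, h0₁, hz₁, hl₁⟩ := hspan fun l => -∑ i, HF.indicator 1 i * a i ⟨k + (l : ℕ), by omega⟩
    set ρ : Fin m → ℝ := fun i => lam₁ i + HF.indicator 1 i with hρ
    obtain ⟨N, hN⟩ := exists_nat_gt
      ((∑ i, ρ i * a i ⟨k - 1, by omega⟩) / -(∑ i, lam₂ i * a i ⟨k - 1, by omega⟩))
    rw [div_lt_iff₀ (neg_pos.2 hneg)] at hN
    set μ : Fin m → ℝ := fun i => N * lam₂ i + ρ i with hμ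
    have hμsum : ∀ j, ∑ i, μ i * a i j = N * (∑ i, lam₂ i * a i j) + ∑ i, ρ i * a i j := by
      intro j
      simp only [hμ, add_mul, Finset.sum_add_distrib, Finset.mul_sum, mul_assoc]
    have hμz : ∀ i, i ∉ HF → μ i = 0 := fun i hi => by
      simp [hμ, hρ, hz₁ i hi, hz₂ i hi, hi]
    have hμpos : ∀ i ∈ HF, 0 < μ i := fun i hi => by
      simp only [hμ, hρ, indicator_of_mem hi, Pi.one_apply]
      have := mul_nonneg (Nat.cast_nonneg (α := ℝ) N) (h0₂ i)
      linarith [h0₁ i]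
    have hμ0 : ∀ i, 0 ≤ μ i := fun i => by
      by_cases hi : i ∈ HF
      exacts [(hμpos i hi).le, (hμz i hi).ge]
    have hμl : ∀ l : Fin (d - k), ∑ i, μ i * a i ⟨k + (l : ℕ), by omega⟩ = 0 := fun l => by
      rw [hμsum, hl₂, mul_zero, zero_add]
      simp only [hρ, add_mul, Finset.sum_add_distrib, hl₁, neg_add_cancel]
    set c : Fin k → ℝ := fun l => ∑ i, μ i * a i (Fin.castLE hkd l) with hc
    have hcx : ∀ x, c ⬝ᵥ p x = ∑ i, μ i * (a i ⬝ᵥ x) := fun x => by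
      rw [sum_mul_dotProduct_eq_add hkd]
      simp only [hμl, zero_mul, Finset.sum_const_zero, add_zero]
      rfl
    have hle : ∀ x ∈ P, c ⬝ᵥ p x ≤ ∑ i, μ i := fun x hx => by
      rw [hP] at hx
      rw [hcx]
      exact Finset.sum_le_sum fun i _ => mul_le_of_le_one_right (hμ0 i) (hx i)
    have hFP : F ⊆ P := hF.1
    have heq : ∀ x ∈ F, c ⬝ᵥ p x = ∑ i, μ i := fun x hx => by
      rw [hcx]
      exact sum_mul_eq_sum_of_tight hμz (htight x hx)
    have hmem : ∀ x ∈ P, c ⬝ᵥ p x = ∑ i, μ i → x ∈ F := fun x hx h => by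
      rw [hP] at hx
      rw [hFt]
      refine ⟨hx, fun i hi => ?_⟩
      rw [hcx, Finset.sum_eq_sum_iff_of_le fun i _ => mul_le_of_le_one_right (hμ0 i) (hx i)] at h
      exact (mul_eq_left₀ (hμpos i hi).ne').1 (h i (Finset.mem_univ i))
    have hface : p '' F = {z ∈ p '' P | c ⬝ᵥ z = ∑ i, μ i} := by
      ext z
      constructor
      · rintro ⟨x, hx, rfl⟩
        exact ⟨mem_image_of_mem p (hFP hx), heq x hx⟩
      · rintro ⟨⟨x, hx, rfl⟩, hz⟩
        exact mem_image_of_mem p (hmem x hx hz)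
    have hle' : ∀ z ∈ p '' P, c ⬝ᵥ z ≤ ∑ i, μ i := by
      rintro _ ⟨x, hx, rfl⟩
      exact hle x hx
    refine ⟨⟨⟨image_mono hFP, dotProductBilin ℝ ℝ c, _, hle', hface⟩,
      nonempty_orderIso_of_factor p hinj hfac, ?_⟩, c, _, ?_, hle', hface⟩
    · ext x
      constructor
      · rintro ⟨⟨y, hy, hyx⟩, hx⟩
        exact hmem x hx (hyx ▸ heq y hy)
      · exact fun hx => ⟨mem_image_of_mem p hx, hFP hx⟩
    · change ∑ i, μ i * a i ⟨k - 1, _⟩ < 0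
      rw [hμsum]
      linarith
end
end
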